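/- For every field k and every integer n ≥ 2, the algebra gn = gr Q_n is Koszul: the trivial right gn-module k = gn/(gn)_{≥1} admits a graded free resolution ⋯ → P_2 → P_1 → P_0 → k → 0 of right gn-modules in which, for every i ≥ 0, the module P_i is a graded free module all of whose free generators lie in degree i (i.e., P_i is a direct sum of copies of gn with grading shifted by i), and all maps are degree-preserving module homomorphisms. -/

import Mathlib

/-!
STATEMENT 2: For every field `k` and every integer `n ≥ 2`, the algebra `gn = gr Q_n`
(presented by the relations `h_{A;i,j} = r_A(r_{A∖i} − r_{A∖j})`) is Koszul: the trivial
right `gn`-module `k = gn/(gn)_{≥1}` admits a graded free resolution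
`⋯ → P_2 → P_1 → P_0 → k → 0` of right `gn`-modules where every `P_i` is a graded free
module all of whose free generators lie in degree `i`, and all maps preserve degrees.

Right `gn`-modules are formalized as left modules over the opposite algebra `R = gnᵐᵒᵖ`;
a graded free module with all generators in degree `i` is formalized concretely as
`β →₀ R` with degree-`m` component `{x | ∀ b, x b ∈ R_{m−i}}` (zero for `m < i`).
-/

noncomputable section

open Finset MulOpposite

/-- Index type for generators: nonempty subsets `A ⊆ I_n = {1,…,n}` (modeled as `Fin n`). -/
abbrev SubsetIdx (n : ℕ) := {A : Finset (Fin n) // A.Nonempty}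

/-- The free associative unital `k`-algebra `F` on the generators `r_A`. -/
abbrev FreeA (k : Type) [Field k] (n : ℕ) := FreeAlgebra k (SubsetIdx n)

/-- The generator `r_A`, with the convention `r_∅ = 0`. -/
def rGen (k : Type) [Field k] (n : ℕ) (A : Finset (Fin n)) : FreeA k n :=
  if h : A.Nonempty then FreeAlgebra.ι k (⟨A, h⟩ : SubsetIdx n) else 0

/-- The quadratic relation `h_{A;i,j} = r_A (r_{A∖i} - r_{A∖j})`. -/
def hRel (k : Type) [Field k] (n : ℕ) (A : Finset (Fin n)) (i j : Fin n) : FreeA k n :=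
  rGen k n A * (rGen k n (A.erase i) - rGen k n (A.erase j))

/-- The relation identifying each `h_{A;i,j}` (for `i, j ∈ A`) with `0`. -/
inductive GnRel (k : Type) [Field k] (n : ℕ) : FreeA k n → FreeA k n → Prop
  | rel (A : Finset (Fin n)) (i j : Fin n) (hi : i ∈ A) (hj : j ∈ A) :
      GnRel k n (hRel k n A i j) 0

/-- The algebra `gn = F/I`. -/
abbrev Gn (k : Type) [Field k] (n : ℕ) := RingQuot (GnRel k n)

/-- The quotient map `F → gn`. -/
def GnMk (k : Type) [Field k] (n : ℕ) : FreeA k n →ₐ[k] Gn k n :=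
  RingQuot.mkAlgHom k (GnRel k n)

/-- The degree-`d` component of `F`: the `k`-span of the words of length `d`. -/
def FreeADeg (k : Type) [Field k] (n : ℕ) (d : ℕ) : Submodule k (FreeA k n) :=
  Submodule.span k
    {x | ∃ l : List (SubsetIdx n), l.length = d ∧ x = (l.map (FreeAlgebra.ι k)).prod}

/-- The degree-`d` graded component of `gn` (image of that of `F`; the relations are
homogeneous of degree `2`, so `gn` inherits the grading of `F`). -/
def GnDeg (k : Type) [Field k] (n : ℕ) (d : ℕ) : Submodule k (Gn k n) :=
  (FreeADeg k n d).map (GnMk k n).toLinearMap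

/-- The opposite algebra `R = gnᵐᵒᵖ`; left `R`-modules are right `gn`-modules. -/
abbrev GnOp (k : Type) [Field k] (n : ℕ) := (Gn k n)ᵐᵒᵖ

/-- The degree-`d` graded component of `R = gnᵐᵒᵖ`. -/
def GnOpDeg (k : Type) [Field k] (n : ℕ) (d : ℕ) : Submodule k (GnOp k n) :=
  (GnDeg k n d).map (opLinearEquiv k).toLinearMap

/-- The augmentation ideal `(gn)_{≥1}`, spanned by the elements of positive degree, as a
left ideal of `R = gnᵐᵒᵖ` (i.e. as a right ideal of `gn`). -/
def augIdealG (k : Type) [Field k] (n : ℕ) : Ideal (GnOp k n) :=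
  Ideal.span {x : GnOp k n | ∃ d : ℕ, 1 ≤ d ∧ x ∈ GnOpDeg k n d}

/-- The trivial right `gn`-module `k = gn/(gn)_{≥1}`. -/
abbrev TrivG (k : Type) [Field k] (n : ℕ) := GnOp k n ⧸ augIdealG k n

/-- The degree-`m` component of the free right `gn`-module shifted by `i` (all free
generators in degree `i`): it is `R_{m−i}` for `m ≥ i` and `0` for `m < i`. -/
def shiftDegG (k : Type) [Field k] (n : ℕ) (i m : ℕ) : Submodule k (GnOp k n) :=
  if i ≤ m then GnOpDeg k n (m - i) else ⊥

namespace BooleanKoszul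

variable {ι : Type*} [LinearOrder ι] {R : Type*} [Ring R]

/-- The sign `(-1)^#{i ∈ I | i < j}` attached to inserting `j` into `I`. -/
def insertSign (j : ι) (I : Finset ι) : ℤ := (-1) ^ (I.filter (· < j)).card

lemma insertSign_mul_self (j : ι) (I : Finset ι) : insertSign j I * insertSign j I = 1 := by
  rw [insertSign, ← pow_add, ← two_mul, pow_mul]; simp

lemma insertSign_insert {j m : ι} {I : Finset ι} (hm : m ∉ I) :
    insertSign j (insert m I) = (if m < j then -1 else 1) * insertSign j I := by
  unfold insertSign
  rw [filter_insert]
  split_ifs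
  · rw [card_insert_of_notMem (by simp [hm]), pow_succ, mul_comm]
  · simp

lemma insertSign_swap {i j : ι} {I : Finset ι} (hij : i ≠ j) (hi : i ∉ I) (hj : j ∉ I) :
    insertSign i I * insertSign j (insert i I) = -(insertSign j I * insertSign i (insert j I)) := by
  rw [insertSign_insert hi, insertSign_insert hj]
  rcases lt_or_gt_of_ne hij with h | h
  · simp [h, h.not_gt, mul_comm]
  · simp [h, h.not_gt, mul_comm]

lemma insertSign_cross {i j : ι} {I : Finset ι} (hij : i ≠ j) (hi : i ∉ I) (hj : j ∉ I) :
    insertSign j (insert i I) * insertSign i (insert j I) = -(insertSign i I * insertSign j I) := by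
  rw [insertSign_insert hi, insertSign_insert hj]
  rcases lt_or_gt_of_ne hij with h | h
  · simp [h, h.not_gt, mul_comm]
  · simp [h, h.not_gt, mul_comm]

/-- The simplicial boundary on chains of the full simplex on `A`. -/
def bd (A : Finset ι) : (Finset ι → R) →ₗ[R] (Finset ι → R) where
  toFun b I := ∑ j ∈ A \ I, insertSign j I • b (insert j I)
  map_add' b c := by ext I; simp [sum_add_distrib]
  map_smul' r b := by
    ext I
    simp only [Pi.smul_apply, RingHom.id_apply, smul_sum]
    exact sum_congr rfl fun j _ => smul_comm _ _ _

lemma bd_apply (A : Finset ι) (b : Finset ι → R) (I : Finset ι) :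
    bd A b I = ∑ j ∈ A \ I, insertSign j I • b (insert j I) := rfl

/-- The cone operator with apex `m`. -/
def cone (m : ι) : (Finset ι → R) →ₗ[R] (Finset ι → R) where
  toFun b L := if m ∈ L then insertSign m (L.erase m) • b (L.erase m) else 0
  map_add' b c := by ext L; by_cases h : m ∈ L <;> simp [h]
  map_smul' r b := by
    ext L
    by_cases h : m ∈ L
    · simpa [h] using smul_comm (insertSign m (L.erase m)) r (b (L.erase m))
    · simp [h]

lemma cone_apply (m : ι) (b : Finset ι → R) (L : Finset ι) :
    cone m b L = if m ∈ L then insertSign m (L.erase m) • b (L.erase m) else 0 := rfl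

lemma bd_mem {A I : Finset ι} {b : Finset ι → R} {N : Submodule R R}
    (h : ∀ j ∈ A \ I, b (insert j I) ∈ N) : bd A b I ∈ N :=
  sum_mem fun j hj => zsmul_mem (h j hj) _

lemma bd_congr {A I : Finset ι} {b c : Finset ι → R}
    (h : ∀ j ∈ A \ I, b (insert j I) = c (insert j I)) : bd A b I = bd A c I :=
  sum_congr rfl fun j hj => by rw [h j hj]

lemma insert_subset_card {A I : Finset ι} {j : ι} (hI : I ⊆ A) (hj : j ∈ A \ I) :
    insert j I ⊆ A ∧ (insert j I).card = I.card + 1 := by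
  rw [mem_sdiff] at hj
  exact ⟨insert_subset hj.1 hI, card_insert_of_notMem hj.2⟩

lemma bd_congr_of_card {A I : Finset ι} {b c : Finset ι → R} {l : ℕ}
    (h : ∀ L ⊆ A, L.card = l → b L = c L) (hI : I ⊆ A) (hc : I.card + 1 = l) :
    bd A b I = bd A c I :=
  bd_congr fun _ hj => h _ (insert_subset_card hI hj).1 ((insert_subset_card hI hj).2.trans hc)

lemma bd_bd (A : Finset ι) (b : Finset ι → R) (I : Finset ι) : bd A (bd A b) I = 0 := by
  simp only [bd_apply, smul_sum]
  rw [sum_sigma']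
  refine sum_involution (fun p _ => ⟨p.2, p.1⟩) ?_ ?_ ?_ ?_
  · rintro ⟨i, j⟩ h
    simp only [mem_sigma, mem_sdiff, mem_insert, not_or] at h
    rw [Finset.insert_comm j i, smul_smul, smul_smul,
      insertSign_swap (Ne.symm h.2.2.1) h.1.2 h.2.2.2, neg_smul, neg_add_cancel]
  · rintro ⟨i, j⟩ h _ h'
    simp only [mem_sigma, mem_sdiff, mem_insert, not_or] at h
    simp only [Sigma.mk.injEq, heq_eq_eq] at h'
    exact h.2.2.1 h'.1
  · rintro ⟨i, j⟩ h
    simp only [mem_sigma, mem_sdiff, mem_insert, not_or] at h ⊢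
    exact ⟨⟨h.2.1, h.2.2.2⟩, h.1.1, Ne.symm h.2.2.1, h.1.2⟩
  · rintro ⟨i, j⟩ h
    rfl

lemma bd_cone_of_notMem {A L : Finset ι} {m : ι} (hm : m ∈ A) (hL : m ∉ L) (b : Finset ι → R) :
    bd A (cone m b) L = b L := by
  rw [bd_apply, sum_eq_single_of_mem m (by simp [hm, hL])]
  · rw [cone_apply, if_pos (mem_insert_self _ _), erase_insert hL, smul_smul,
      insertSign_mul_self, one_smul]
  · intro j _ hj
    rw [cone_apply, if_neg (by simp [hL, Ne.symm hj]), smul_zero]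

lemma bd_cone_add_cone_bd {A : Finset ι} {m : ι} (hm : m ∈ A) (b : Finset ι → R)
    (L : Finset ι) : bd A (cone m b) L + cone m (bd A b) L = b L := by
  by_cases hL : m ∈ L
  · obtain ⟨I, hI, rfl⟩ : ∃ I, m ∉ I ∧ insert m I = L :=
      ⟨L.erase m, notMem_erase _ _, insert_erase hL⟩
    have hA : A \ I = insert m (A \ insert m I) := by
      ext x; by_cases hx : x = m <;> simp [hx, hm, hI]
    rw [cone_apply, if_pos hL, erase_insert hI, bd_apply, bd_apply, hA,
      sum_insert (by simp), smul_add, smul_smul, insertSign_mul_self, one_smul, add_left_comm,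
      add_eq_left, smul_sum, ← sum_add_distrib]
    refine sum_eq_zero fun j hj => ?_
    simp only [mem_sdiff, mem_insert, not_or] at hj
    have hmj : m ∉ insert j I := by simp [hI, Ne.symm hj.2.1]
    rw [Finset.insert_comm, cone_apply, if_pos (mem_insert_self _ _), erase_insert hmj, smul_smul,
      smul_smul, insertSign_cross (Ne.symm hj.2.1) hI hj.2.2, neg_smul, neg_add_cancel]
  · rw [bd_cone_of_notMem hm hL, cone_apply, if_neg hL, add_zero]

lemma sub_bd_cone_mem {A : Finset ι} {m : ι} (hm : m ∈ A) {b : Finset ι → R} {l : ℕ}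
    {N : Submodule R R} (h : ∀ I ⊆ A, I.card + 1 = l → bd A b I ∈ N) {L : Finset ι}
    (hL : L ⊆ A) (hl : L.card = l) : b L - bd A (cone m b) L ∈ N := by
  rw [← bd_cone_add_cone_bd hm b L, add_sub_cancel_left, cone_apply]
  split_ifs with hmL
  · exact zsmul_mem (h _ ((erase_subset _ _).trans hL) (by rw [card_erase_add_one hmL, hl])) _
  · exact zero_mem _

lemma eq_bd_cone {A : Finset ι} {m : ι} (hm : m ∈ A) {b : Finset ι → R} {l : ℕ}
    (h : ∀ I ⊆ A, I.card + 1 = l → bd A b I = 0) {L : Finset ι}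
    (hL : L ⊆ A) (hl : L.card = l) : b L = bd A (cone m b) L := by
  simpa [sub_eq_zero] using sub_bd_cone_mem (N := ⊥) hm (by simpa using h) hL hl

lemma bd_sum_powersetCard (A : Finset ι) (e : ℕ) (f : Finset ι → Finset ι → R) (I : Finset ι) :
    bd A (fun L => ∑ D ∈ powersetCard e (A \ L), f L D) I =
      ∑ D ∈ powersetCard e (A \ I), bd (A \ D) (fun L => f L D) I := by
  simp only [bd_apply, smul_sum]
  refine sum_comm' fun j D => ?_
  simp only [mem_powersetCard, mem_sdiff, subset_iff, mem_insert]
  grind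

/-- The left ideal generated by the differences `ρ D - ρ D'`, for `D, D' ⊆ X` of size `e`. -/
def diffIdeal (ρ : Finset ι → R) (X : Finset ι) (e : ℕ) : Submodule R R :=
  Submodule.span R {x | ∃ D ∈ powersetCard e X, ∃ D' ∈ powersetCard e X, x = ρ D - ρ D'}

variable {ρ : Finset ι → R}

omit [LinearOrder ι] in
lemma sub_mem_diffIdeal {X D D' : Finset ι} {e : ℕ} (h : D ∈ powersetCard e X)
    (h' : D' ∈ powersetCard e X) : ρ D - ρ D' ∈ diffIdeal ρ X e :=
  Submodule.subset_span ⟨D, h, D', h', rfl⟩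

omit [LinearOrder ι] in
lemma diffIdeal_mono {X Y : Finset ι} (h : X ⊆ Y) (e : ℕ) :
    diffIdeal ρ X e ≤ diffIdeal ρ Y e :=
  Submodule.span_mono fun _ ⟨D, hD, D', hD', hx⟩ =>
    ⟨D, powersetCard_mono h hD, D', powersetCard_mono h hD', hx⟩

omit [LinearOrder ι] in
lemma diffIdeal_zero (X : Finset ι) : diffIdeal ρ X 0 = ⊥ := by
  rw [diffIdeal, Submodule.span_eq_bot]
  simp

omit [LinearOrder ι] in
lemma sum_mul_sub_mem_diffIdeal {X D₀ : Finset ι} {e : ℕ} (y : Finset ι → R)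
    (h : D₀ ∈ powersetCard e X) :
    ∑ D ∈ powersetCard e X, y D * ρ D - (∑ D ∈ powersetCard e X, y D) * ρ D₀
      ∈ diffIdeal ρ X e := by
  rw [sum_mul, ← sum_sub_distrib]
  refine sum_mem fun D hD => ?_
  rw [← mul_sub]
  exact Submodule.smul_mem _ _ (sub_mem_diffIdeal hD h)

lemma exists_sum_of_mem_diffIdeal {X : Finset ι} {e : ℕ} {x : R} (hx : x ∈ diffIdeal ρ X e) :
    ∃ y : Finset ι → R, x = ∑ D ∈ powersetCard e X, y D * ρ D ∧
      ∑ D ∈ powersetCard e X, y D = 0 := by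
  induction hx using Submodule.span_induction with
  | mem x h =>
    obtain ⟨D, hD, D', hD', rfl⟩ := h
    refine ⟨fun C => (if C = D then 1 else 0) - (if C = D' then 1 else 0), ?_, ?_⟩
    · simp [sub_mul, hD, hD', sum_sub_distrib]
    · simp [hD, hD', sum_sub_distrib]
  | zero => exact ⟨0, by simp, by simp⟩
  | add x x' _ _ h h' =>
    obtain ⟨y, rfl, hy⟩ := h
    obtain ⟨y', rfl, hy'⟩ := h'
    exact ⟨y + y', by simp [add_mul, sum_add_distrib], by simp [sum_add_distrib, hy, hy']⟩
  | smul r x _ h =>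
    obtain ⟨y, rfl, hy⟩ := h
    exact ⟨r • y, by simp [mul_sum, mul_assoc], by simp [← mul_sum, hy]⟩

lemma sub_mem_iSup_diffIdeal {X D' : Finset ι} {e : ℕ} (hD' : D' ∈ powersetCard e X) (r : ℕ) :
    ∀ D ∈ powersetCard e X, (D \ D').card = r →
      ρ D - ρ D' ∈ ⨆ C ∈ powersetCard (e + 1) X, diffIdeal ρ C e := by
  rw [mem_powersetCard] at hD'
  induction r with
  | zero =>
    intro D hD hr
    rw [mem_powersetCard] at hD
    rw [card_eq_zero, sdiff_eq_empty_iff_subset] at hr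
    rw [eq_of_subset_of_card_le hr (by omega), sub_self]
    exact zero_mem _
  | succ r ih =>
    intro D hD hr
    rw [mem_powersetCard] at hD
    have hne : D ≠ D' := by rintro rfl; simp at hr
    obtain ⟨i, hi⟩ : (D \ D').Nonempty := card_pos.1 (by omega)
    obtain ⟨j, hj⟩ : (D' \ D).Nonempty := by
      rw [sdiff_nonempty]
      exact fun h => hne (eq_of_subset_of_card_le h (by omega)).symm
    rw [mem_sdiff] at hi hj
    have hcard : (insert j (D.erase i)).card = e := by
      rw [card_insert_of_notMem (by simp [hj.2]), card_erase_add_one hi.1, hD.2]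
    have key := ih (insert j (D.erase i))
      (by rw [mem_powersetCard]
          exact ⟨insert_subset (hD'.1 hj.1) ((erase_subset _ _).trans hD.1), hcard⟩)
      (by rw [insert_sdiff_of_mem _ hj.1, erase_sdiff_comm, card_erase_of_mem (by simp [hi]), hr]
          rfl)
    rw [← sub_add_sub_cancel _ (ρ (insert j (D.erase i)))]
    refine add_mem ?_ key
    refine Submodule.mem_iSup_of_mem (insert j D) (Submodule.mem_iSup_of_mem ?_ ?_)
    · rw [mem_powersetCard]
      exact ⟨insert_subset (hD'.1 hj.1) hD.1, by rw [card_insert_of_notMem hj.2, hD.2]⟩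
    · refine sub_mem_diffIdeal ?_ ?_ <;> rw [mem_powersetCard]
      · exact ⟨subset_insert _ _, hD.2⟩
      · exact ⟨insert_subset_insert _ (erase_subset _ _), hcard⟩

lemma exists_sum_diffIdeal {X : Finset ι} {e : ℕ} {x : R} (hx : x ∈ diffIdeal ρ X e) :
    ∃ g : Finset ι → R, (∀ D ∈ powersetCard (e + 1) X, g D ∈ diffIdeal ρ D e) ∧
      ∑ D ∈ powersetCard (e + 1) X, g D = x := by
  have : diffIdeal ρ X e ≤ ⨆ C ∈ powersetCard (e + 1) X, diffIdeal ρ C e :=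
    Submodule.span_le.2 fun _ ⟨D, hD, D', hD', h⟩ =>
      h ▸ sub_mem_iSup_diffIdeal hD' _ D hD rfl
  obtain ⟨g, hg⟩ := (Submodule.mem_iSup_finset_iff_exists_sum _ _).1 (this hx)
  exact ⟨fun D => g D, fun D _ => (g D).2, hg⟩

/-- Right multiplication of the coefficient at `L` by `ρ (A \ L)`. -/
def mulGen (ρ : Finset ι → R) (A : Finset ι) : (Finset ι → R) →ₗ[R] (Finset ι → R) where
  toFun b L := b L * ρ (A \ L)
  map_add' b c := by ext L; simp [add_mul]
  map_smul' r b := by ext L; simp [mul_assoc]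

lemma mulGen_apply (A : Finset ι) (b : Finset ι → R) (L : Finset ι) :
    mulGen ρ A b L = b L * ρ (A \ L) := rfl

lemma bd_mul_right (A : Finset ι) (b : Finset ι → R) (r : R) (I : Finset ι) :
    bd A (fun L => b L * r) I = bd A b I * r := by
  simp only [bd_apply, sum_mul, smul_mul_assoc]

/-- The left annihilator of a combination of generators is as small as the quadratic relations
allow. -/
structure IsQuadratic (ρ : Finset ι → R) : Prop where
  mul_eq_zero : ∀ D : Finset ι, ∀ x ∈ diffIdeal ρ D (D.card - 1), x * ρ D = 0
  mem_of_sum_eq_zero : ∀ (S : Finset (Finset ι)) (x : Finset ι → R), (∀ D ∈ S, D.Nonempty) →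
    ∑ D ∈ S, x D * ρ D = 0 → ∀ D ∈ S, x D ∈ diffIdeal ρ D (D.card - 1)

namespace IsQuadratic

variable (hρ : IsQuadratic ρ)
include hρ

omit [LinearOrder ι] in
lemma mul_eq_zero_of_mem {D : Finset ι} {e : ℕ} (hD : D.card = e + 1) {x : R}
    (hx : x ∈ diffIdeal ρ D e) : x * ρ D = 0 :=
  hρ.mul_eq_zero D x (by rwa [hD])

lemma exists_lift {A : Finset ι} {e l : ℕ} (he : e + 1 < A.card) {z : Finset ι → R}
    (hz : ∀ I ⊆ A, I.card + 1 = l → z I ∈ diffIdeal ρ (A \ I) (e + 1))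
    (hbd : ∀ I ⊆ A, I.card + 2 = l → bd A z I = 0) :
    ∃ w : Finset ι → Finset ι → R,
      (∀ I ⊆ A, I.card + 1 = l →
        bd A (fun L => ∑ D ∈ powersetCard (e + 1) (A \ L), w L D) I ∈ diffIdeal ρ (A \ I) e) ∧
      ∀ I ⊆ A, I.card + 1 = l →
        bd A (fun L => ∑ D ∈ powersetCard (e + 1) (A \ L), w L D * ρ D) I = z I := by
  have hy : ∀ I : Finset ι, ∃ y : Finset ι → R, I ⊆ A → I.card + 1 = l →
      z I = ∑ D ∈ powersetCard (e + 1) (A \ I), y D * ρ D ∧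
        ∑ D ∈ powersetCard (e + 1) (A \ I), y D = 0 := by
    intro I
    by_cases h : I ⊆ A ∧ I.card + 1 = l
    · obtain ⟨y, hy⟩ := exists_sum_of_mem_diffIdeal (hz I h.1 h.2)
      exact ⟨y, fun _ _ => hy⟩
    · exact ⟨0, fun h1 h2 => (h ⟨h1, h2⟩).elim⟩
  choose y hy using hy
  have hm : ∀ D : Finset ι, ∃ m, D.card = e + 1 → m ∈ A \ D := by
    intro D
    by_cases hD : D.card = e + 1
    · obtain ⟨m, hm⟩ : (A \ D).Nonempty := by
        rw [sdiff_nonempty]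
        exact fun h => by have := card_le_card h; omega
      exact ⟨m, fun _ => hm⟩
    · obtain ⟨m, -⟩ : A.Nonempty := card_pos.1 (by omega)
      exact ⟨m, fun h => (hD h).elim⟩
  choose m hm using hm
  have hcyc : ∀ D ⊆ A, D.card = e + 1 → ∀ I ⊆ A \ D, I.card + 1 + 1 = l →
      bd (A \ D) (fun I => y I D) I ∈ diffIdeal ρ D e := by
    intro D hDA hD I hI hl
    have hIA : I ⊆ A := hI.trans sdiff_subset
    have h0 := hbd I hIA hl
    rw [bd_congr_of_card (c := fun J => ∑ D ∈ powersetCard (e + 1) (A \ J), y J D * ρ D)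
      (fun L hL hc => (hy L hL (hc ▸ hl)).1) hIA rfl, bd_sum_powersetCard] at h0
    simp only [bd_mul_right] at h0
    have := hρ.mem_of_sum_eq_zero _ _ (fun C hC => ?_) h0 D ?_
    · rwa [hD] at this
    · exact card_pos.1 (by rw [(mem_powersetCard.1 hC).2]; omega)
    · rw [mem_powersetCard]
      exact ⟨subset_sdiff.2 ⟨hDA, (subset_sdiff.1 hI).2.symm⟩, hD⟩
  have hw : ∀ I ⊆ A, I.card + 1 = l → ∀ D ∈ powersetCard (e + 1) (A \ I),
      y I D - bd (A \ D) (cone (m D) fun I => y I D) I ∈ diffIdeal ρ D e := by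
    intro I hI hl D hD
    rw [mem_powersetCard, subset_sdiff] at hD
    refine sub_bd_cone_mem (b := fun I => y I D) (l := I.card) (hm D hD.2)
      (fun J hJ hc => hcyc D hD.1.1 hD.2 J hJ (by omega)) (subset_sdiff.2 ⟨hI, hD.1.2.symm⟩) rfl
  refine ⟨fun L D => cone (m D) (fun I => y I D) L, fun I hI hl => ?_, fun I hI hl => ?_⟩
  · rw [bd_sum_powersetCard, ← sub_zero (∑ D ∈ _, _), ← (hy I hI hl).2, ← sum_sub_distrib]
    refine sum_mem fun D hD => ?_
    rw [← neg_sub]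
    exact neg_mem (diffIdeal_mono (mem_powersetCard.1 hD).1 e (hw I hI hl D hD))
  · rw [bd_sum_powersetCard, (hy I hI hl).1]
    refine sum_congr rfl fun D hD => ?_
    rw [bd_mul_right, eq_comm, ← sub_eq_zero, ← sub_mul]
    exact hρ.mul_eq_zero_of_mem (mem_powersetCard.1 hD).2 (hw I hI hl D hD)

lemma exists_bd_of_bd_mem {e : ℕ} : ∀ {A : Finset ι} {l : ℕ} (_ : l + e < A.card)
    (s : Finset ι → R) (_ : ∀ I ⊆ A, I.card + 1 = l → bd A s I ∈ diffIdeal ρ (A \ I) e),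
    ∃ t : Finset ι → R, ∀ L ⊆ A, L.card = l → s L - bd A t L ∈ diffIdeal ρ (A \ L) e := by
  induction e with
  | zero =>
    intro A l he s hs
    obtain ⟨m, hm⟩ : A.Nonempty := card_pos.1 (by omega)
    simp only [diffIdeal_zero] at hs ⊢
    exact ⟨cone m s, fun L hL hl => sub_bd_cone_mem hm hs hL hl⟩
  | succ e ih =>
    intro A l he s hs
    obtain ⟨m, hm⟩ : A.Nonempty := card_pos.1 (by omega)
    obtain ⟨w, hw, hwz⟩ := hρ.exists_lift (by omega) hs fun I _ _ => bd_bd A s I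
    obtain ⟨T, hT⟩ := ih (by omega) _ hw
    have hg : ∀ L : Finset ι, ∃ g : Finset ι → R, L ⊆ A → L.card = l →
        (∀ D ∈ powersetCard (e + 1) (A \ L), g D ∈ diffIdeal ρ D e) ∧
        ∑ D ∈ powersetCard (e + 1) (A \ L), g D =
          ∑ D ∈ powersetCard (e + 1) (A \ L), w L D - bd A T L := by
      intro L
      by_cases h : L ⊆ A ∧ L.card = l
      · obtain ⟨g, hg⟩ := exists_sum_diffIdeal (hT L h.1 h.2)
        exact ⟨g, fun _ _ => hg⟩
      · exact ⟨0, fun h1 h2 => (h ⟨h1, h2⟩).elim⟩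
    choose g hg using hg
    have hD : ∀ L : Finset ι, ∃ D, L ⊆ A → L.card ≤ l + 1 →
        D ∈ powersetCard (e + 1) (A \ L) := by
      intro L
      by_cases h : L ⊆ A ∧ L.card ≤ l + 1
      · obtain ⟨D, hD⟩ := powersetCard_nonempty.2
          (show e + 1 ≤ (A \ L).card by rw [card_sdiff_of_subset h.1]; omega)
        exact ⟨D, fun _ _ => hD⟩
      · exact ⟨∅, fun h1 h2 => (h ⟨h1, h2⟩).elim⟩
    choose C hC using hD
    set V : Finset ι → R := fun E => T E * ρ (C E) with hV
    set U : Finset ι → R := fun L => ∑ D ∈ powersetCard (e + 1) (A \ L), w L D * ρ D with hU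
    have hUV : ∀ L ⊆ A, L.card = l → U L - bd A V L ∈ diffIdeal ρ (A \ L) (e + 1) := by
      intro L hL hl
      have hCL := hC L hL (by omega)
      have h1 : U L = ∑ D ∈ powersetCard (e + 1) (A \ L), (w L D - g L D) * ρ D := by
        refine sum_congr rfl fun D hD => ?_
        rw [sub_mul, hρ.mul_eq_zero_of_mem (mem_powersetCard.1 hD).2 ((hg L hL hl).1 D hD),
          sub_zero]
      have h2 := sum_mul_sub_mem_diffIdeal (ρ := ρ) (fun D => w L D - g L D) hCL
      rw [← h1, sum_sub_distrib, (hg L hL hl).2, sub_sub_cancel] at h2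
      rw [← sub_add_sub_cancel]
      refine add_mem h2 ?_
      rw [← bd_mul_right, ← Pi.sub_apply, ← map_sub]
      refine bd_mem fun j hj => ?_
      have hj' := insert_subset_card hL hj
      rw [Pi.sub_apply, hV, ← mul_sub]
      exact Submodule.smul_mem _ _ (sub_mem_diffIdeal hCL (powersetCard_mono
        (sdiff_subset_sdiff subset_rfl (subset_insert _ _)) (hC _ hj'.1 (by omega))))
    refine ⟨cone m (s - (U - bd A V)), fun L hL hl => ?_⟩
    have h3 : (s - (U - bd A V)) L = bd A (cone m (s - (U - bd A V))) L := by
      refine eq_bd_cone hm (fun I hI hc => ?_) hL hl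
      rw [map_sub, map_sub, Pi.sub_apply, Pi.sub_apply, bd_bd, sub_zero, hwz I hI hc, sub_self]
    rw [← h3, Pi.sub_apply, sub_sub_cancel]
    exact hUV L hL hl

lemma exists_cycle {A : Finset ι} {l : ℕ} {b : Finset ι → R}
    (hb : ∀ I ⊆ A, I.card + 1 = l → bd A b I = 0)
    (hJ : ∀ I ⊆ A, I.card = l → b I ∈ diffIdeal ρ (A \ I) ((A \ I).card - 1)) :
    ∃ c : Finset ι → R, (∀ I, bd A c I = 0) ∧
      ∀ I ⊆ A, I.card = l → bd A (mulGen ρ A c) I = b I := by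
  rcases lt_or_ge (l + 1) A.card with hl | hl
  · obtain ⟨e, he⟩ := Nat.exists_eq_add_of_lt hl
    have hcard : ∀ L ⊆ A, L.card = l + 1 → (A \ L).card = e + 1 := fun L hL hc => by
      rw [card_sdiff_of_subset hL]; omega
    obtain ⟨w, hw, hwb⟩ := hρ.exists_lift (e := e) (l := l + 1) (by omega)
      (fun I hI hc => by
        have := hJ I hI (by omega)
        rwa [card_sdiff_of_subset hI, show A.card - I.card - 1 = e + 1 by omega] at this)
      (fun I hI hc => hb I hI (by omega))
    obtain ⟨T, hT⟩ := hρ.exists_bd_of_bd_mem (by omega) _ hw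
    refine ⟨bd A T, bd_bd A T, fun I hI hc => ?_⟩
    rw [← hwb I hI (by omega)]
    refine bd_congr_of_card (fun L hL hL' => ?_) hI rfl
    have hA := hcard L hL (by omega)
    have hT' := hT L hL (by omega)
    rw [← hA, powersetCard_self, sum_singleton] at hT' ⊢
    rw [mulGen_apply, eq_comm, ← sub_eq_zero, ← sub_mul]
    refine hρ.mul_eq_zero_of_mem hA hT'
  · refine ⟨0, by simp, fun I hI hc => ?_⟩
    have := hJ I hI hc
    rw [card_sdiff_of_subset hI, show A.card - I.card - 1 = 0 by omega, diffIdeal_zero] at this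
    simpa using this.symm

lemma mem_of_bd_mulGen_eq_zero {A I : Finset ι} {b : Finset ι → R}
    (h : bd A (mulGen ρ A b) I = 0) {j : ι} (hj : j ∈ A \ I) (hA : (A \ insert j I).Nonempty) :
    b (insert j I) ∈ diffIdeal ρ (A \ insert j I) ((A \ insert j I).card - 1) := by
  have hinj : ∀ i ∈ A \ I, ∀ i' ∈ A \ I, A \ insert i I = A \ insert i' I → i = i' := by
    intro i hi i' hi' hii
    by_contra hne
    have : i ∈ A \ insert i' I := by
      rw [mem_sdiff] at hi ⊢
      simp [hi, hne]
    rw [← hii] at this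
    simp at this
  have hcard : ∀ i ∈ A \ I, (A \ insert i I).card = (A \ I).card - 1 := by
    intro i hi
    rw [sdiff_insert, card_erase_of_mem hi]
  set x : Finset ι → R := fun D =>
    ∑ i ∈ A \ I with A \ insert i I = D, insertSign i I • b (insert i I) with hx
  have hsum : ∑ D ∈ (A \ I).image (fun i => A \ insert i I), x D * ρ D = 0 := by
    rw [← h, bd_apply, ← sum_fiberwise_of_maps_to (t := (A \ I).image fun i => A \ insert i I)
      (g := fun i => A \ insert i I) fun i hi => mem_image_of_mem _ hi]
    refine sum_congr rfl fun D _ => ?_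
    rw [hx, sum_mul]
    refine sum_congr rfl fun i hi => ?_
    rw [mulGen_apply, (mem_filter.1 hi).2, smul_mul_assoc]
  have hmem := hρ.mem_of_sum_eq_zero _ _ ?_ hsum _ (mem_image_of_mem _ hj)
  · have hfilter : (A \ I).filter (fun i => A \ insert i I = A \ insert j I) = {j} := by
      ext i
      rw [mem_filter, mem_singleton]
      exact ⟨fun hi => hinj _ hi.1 _ hj hi.2, fun hi => by subst hi; exact ⟨hj, rfl⟩⟩
    rw [hx] at hmem
    simp only [hfilter, sum_singleton] at hmem
    have := zsmul_mem hmem (insertSign j I)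
    rwa [smul_smul, insertSign_mul_self, one_smul] at this
  · intro D hD
    obtain ⟨i, hi, rfl⟩ := mem_image.1 hD
    rw [← card_pos, hcard i hi, ← hcard j hj]
    exact card_pos.2 hA

end IsQuadratic

lemma bd_mulGen_mem {A I : Finset ι} {b : Finset ι → R} (h : bd A b I = 0) :
    bd A (mulGen ρ A b) I ∈ diffIdeal ρ (A \ I) ((A \ I).card - 1) := by
  rcases (A \ I).eq_empty_or_nonempty with hI | ⟨i, hi⟩
  · rw [bd_apply, hI, sum_empty]
    exact zero_mem _
  have hmem : ∀ j ∈ A \ I, A \ insert j I ∈ powersetCard ((A \ I).card - 1) (A \ I) := by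
    intro j hj
    rw [mem_powersetCard, sdiff_insert, card_erase_of_mem hj]
    exact ⟨erase_subset _ _, rfl⟩
  rw [← sub_zero (bd A (mulGen ρ A b) I), ← zero_mul (ρ (A \ insert i I)), ← h, ← bd_mul_right,
    ← Pi.sub_apply, ← map_sub]
  refine bd_mem fun j hj => ?_
  rw [Pi.sub_apply, mulGen_apply, ← mul_sub]
  exact Submodule.smul_mem _ _ (sub_mem_diffIdeal (hmem j hj) (hmem i hi))

/-- Basis of the term of the resolution attached to chains of length `l`: pairs `(A, L)` with `A`
nonempty and `L ⊆ A` of size `l` avoiding the apex chosen in `A`. -/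
abbrev ResIdx (apex : Finset ι → ι) (l : ℕ) :=
  {p : Finset ι × Finset ι // p.1.Nonempty ∧ p.2 ⊆ p.1 ∧ apex p.1 ∉ p.2 ∧ p.2.card = l}

variable {apex : Finset ι → ι} {l : ℕ}

/-- Extension by zero of the `A`-part of a family of coefficients. -/
def toChain (apex : Finset ι → ι) (l : ℕ) (A : Finset ι) :
    (ResIdx apex l →₀ R) →ₗ[R] (Finset ι → R) where
  toFun x L := if h : _ then x ⟨(A, L), h⟩ else 0
  map_add' x y := by ext L; dsimp only [Pi.add_apply]; split_ifs <;> simp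
  map_smul' r x := by ext L; dsimp only [Pi.smul_apply]; split_ifs <;> simp

/-- The cycle determined by its coefficients away from the apex. -/
def cycle (apex : Finset ι → ι) (l : ℕ) (A : Finset ι) :
    (ResIdx apex l →₀ R) →ₗ[R] (Finset ι → R) :=
  bd A ∘ₗ cone (apex A) ∘ₗ toChain apex l A

lemma toChain_apply (x : ResIdx apex l →₀ R) (p : ResIdx apex l) :
    toChain apex l p.1.1 x p.1.2 = x p := dif_pos p.2

lemma bd_cycle (A I : Finset ι) (x : ResIdx apex l →₀ R) : bd A (cycle apex l A x) I = 0 :=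
  bd_bd _ _ _

section

variable (hapex : ∀ A : Finset ι, A.Nonempty → apex A ∈ A)
include hapex

lemma cycle_apply (x : ResIdx apex l →₀ R) (p : ResIdx apex l) :
    cycle apex l p.1.1 x p.1.2 = x p :=
  (bd_cone_of_notMem (hapex _ p.2.1) p.2.2.2.1 _).trans (toChain_apply x p)

lemma cycle_eq {A : Finset ι} (hA : A.Nonempty) {c : Finset ι → R} {x : ResIdx apex l →₀ R}
    (hc : ∀ I ⊆ A, I.card + 1 = l → bd A c I = 0)
    (hx : ∀ p : ResIdx apex l, p.1.1 = A → x p = c p.1.2) {L : Finset ι}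
    (hL : L ⊆ A) (hl : L.card = l) : cycle apex l A x L = c L := by
  rw [eq_bd_cone (hapex A hA) hc hL hl]
  refine bd_congr_of_card (fun J hJ hJc => ?_) hL rfl
  change cone _ _ _ = _
  rw [cone_apply, cone_apply]
  split_ifs with hm
  · rw [← hx ⟨(A, J.erase (apex A)), hA, (erase_subset _ _).trans hJ, notMem_erase _ _,
      by rw [card_erase_of_mem hm]; omega⟩ rfl, ← toChain_apply]
  · rfl

end

variable [Finite ι]

/-- The differentials of the resolution in positive homological degree. -/
def resDiff (ρ : Finset ι → R) (apex : Finset ι → ι) (l : ℕ) :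
    (ResIdx apex (l + 1) →₀ R) →ₗ[R] (ResIdx apex l →₀ R) :=
  (Finsupp.linearEquivFunOnFinite R R (ResIdx apex l)).symm.toLinearMap ∘ₗ
    LinearMap.pi fun p => LinearMap.proj p.1.2 ∘ₗ bd p.1.1 ∘ₗ mulGen ρ p.1.1 ∘ₗ
      cycle apex (l + 1) p.1.1

lemma resDiff_apply (x : ResIdx apex (l + 1) →₀ R) (p : ResIdx apex l) :
    resDiff ρ apex l x p = bd p.1.1 (mulGen ρ p.1.1 (cycle apex (l + 1) p.1.1 x)) p.1.2 := rfl

lemma resDiff_mem {N N' : AddSubgroup R} (h : ∀ x ∈ N, ∀ D, x * ρ D ∈ N')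
    {x : ResIdx apex (l + 1) →₀ R} (hx : ∀ p, x p ∈ N) (p : ResIdx apex l) :
    resDiff ρ apex l x p ∈ N' := by
  rw [resDiff_apply, bd_apply]
  refine sum_mem fun j _ => zsmul_mem (h _ ?_ _) _
  refine sum_mem fun i _ => zsmul_mem ?_ _
  rw [LinearMap.comp_apply, cone_apply]
  split_ifs
  · refine zsmul_mem ?_ _
    change dite _ _ _ ∈ N
    split_ifs
    · exact hx _
    · exact zero_mem _
  · exact zero_mem _

section

variable (hρ : IsQuadratic ρ) (hapex : ∀ A : Finset ι, A.Nonempty → apex A ∈ A)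
include hρ hapex

lemma mem_range_resDiff_iff (x : ResIdx apex l →₀ R) :
    x ∈ LinearMap.range (resDiff ρ apex l) ↔
      ∀ A : Finset ι, A.Nonempty → ∀ L ⊆ A, L.card = l →
        cycle apex l A x L ∈ diffIdeal ρ (A \ L) ((A \ L).card - 1) := by
  constructor
  · rintro ⟨y, rfl⟩ A hA L hL hl
    rw [cycle_eq hapex hA (c := bd A (mulGen ρ A (cycle apex (l + 1) A y)))
      (fun I _ _ => bd_bd _ _ _) (fun p hp => by rw [resDiff_apply, hp]) hL hl]
    exact bd_mulGen_mem (bd_cycle _ _ _)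
  · intro h
    have : ∀ A : Finset ι, ∃ c : Finset ι → R, A.Nonempty → (∀ I, bd A c I = 0) ∧
        ∀ I ⊆ A, I.card = l → bd A (mulGen ρ A c) I = cycle apex l A x I := by
      intro A
      by_cases hA : A.Nonempty
      · obtain ⟨c, hc⟩ := hρ.exists_cycle (fun I _ _ => bd_cycle A I x) (h A hA)
        exact ⟨c, fun _ => hc⟩
      · exact ⟨0, fun h => (hA h).elim⟩
    choose c hc using this
    refine ⟨(Finsupp.linearEquivFunOnFinite R R _).symm fun p => c p.1.1 p.1.2, ?_⟩
    ext p
    rw [resDiff_apply, ← cycle_apply hapex x p, ← (hc _ p.2.1).2 _ p.2.2.1 p.2.2.2.2]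
    refine bd_congr_of_card (fun L hL hl => ?_) p.2.2.1 rfl
    rw [mulGen_apply, mulGen_apply, cycle_eq hapex p.2.1 (c := c p.1.1)
      (fun I _ _ => (hc _ p.2.1).1 I) (fun q hq => by rw [← hq]; rfl) hL (by rw [hl, p.2.2.2.2])]

lemma mem_ker_resDiff_iff (x : ResIdx apex (l + 1) →₀ R) :
    x ∈ LinearMap.ker (resDiff ρ apex l) ↔
      ∀ A : Finset ι, A.Nonempty → ∀ L ⊆ A, L.card = l + 1 →
        cycle apex (l + 1) A x L ∈ diffIdeal ρ (A \ L) ((A \ L).card - 1) := by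
  rw [LinearMap.mem_ker]
  constructor
  · intro h A hA L hL hl
    obtain ⟨j, I, hj, rfl, hI⟩ := card_eq_succ.1 hl
    rcases (A \ insert j I).eq_empty_or_nonempty with hAL | hAL
    · rw [show cycle apex (l + 1) A x (insert j I) = 0 by
        change bd A _ _ = 0
        rw [bd_apply, hAL, sum_empty]]
      exact zero_mem _
    · have hIA := (subset_insert _ _).trans hL
      refine hρ.mem_of_bd_mulGen_eq_zero ?_ (mem_sdiff.2 ⟨hL (mem_insert_self _ _), hj⟩) hAL
      rw [← cycle_eq hapex hA (x := 0) (fun I _ _ => bd_bd _ _ _) (fun p hp => ?_) hIA hI,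
        map_zero, Pi.zero_apply]
      rw [← h, resDiff_apply, hp]
  · intro h
    ext p
    rw [resDiff_apply, bd_apply, Finsupp.zero_apply]
    refine sum_eq_zero fun j hj => ?_
    have hj' := insert_subset_card p.2.2.1 hj
    rw [mulGen_apply, hρ.mul_eq_zero _ _ (h _ p.2.1 _ hj'.1 (by rw [hj'.2, p.2.2.2.2])),
      smul_zero]

lemma ker_resDiff :
    LinearMap.ker (resDiff ρ apex l) = LinearMap.range (resDiff ρ apex (l + 1)) := by
  ext x
  rw [mem_ker_resDiff_iff hρ hapex, mem_range_resDiff_iff hρ hapex]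

omit [Finite ι] hρ in
lemma sum_resIdx_zero [Fintype ι] (x : ResIdx apex 0 →₀ R) :
    Finsupp.linearCombination R (fun p : ResIdx apex 0 => ρ p.1.1) x =
      ∑ A : Finset ι with A.Nonempty, cycle apex 0 A x ∅ * ρ A := by
  rw [Finsupp.linearCombination_apply, Finsupp.sum_fintype _ _ (by simp)]
  refine sum_bij (fun p _ => p.1.1) (fun p _ => by simp [p.2.1]) ?_ ?_ ?_
  · rintro ⟨⟨A, L⟩, hp⟩ - ⟨⟨A', L'⟩, hp'⟩ - h
    obtain rfl := card_eq_zero.1 hp.2.2.2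
    obtain rfl := card_eq_zero.1 hp'.2.2.2
    simpa using h
  · intro A hA
    exact ⟨⟨(A, ∅), by simpa using hA⟩, by simp, rfl⟩
  · rintro ⟨⟨A, L⟩, hp⟩ -
    obtain rfl := card_eq_zero.1 hp.2.2.2
    rw [← cycle_apply hapex x ⟨(A, ∅), hp⟩, smul_eq_mul]

lemma ker_linearCombination :
    LinearMap.ker (Finsupp.linearCombination R (fun p : ResIdx apex 0 => ρ p.1.1)) =
      LinearMap.range (resDiff ρ apex 0) := by
  cases nonempty_fintype ι
  ext x
  rw [mem_range_resDiff_iff hρ hapex, LinearMap.mem_ker, sum_resIdx_zero hapex]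
  constructor
  · intro h A hA L hL hl
    obtain rfl := card_eq_zero.1 hl
    rw [sdiff_empty]
    exact hρ.mem_of_sum_eq_zero _ (fun A => cycle apex 0 A x ∅) (fun D hD => by simpa using hD)
      h A (by simpa using hA)
  · intro h
    refine sum_eq_zero fun A hA => ?_
    have := h A (by simpa using hA) ∅ (empty_subset _) rfl
    rw [sdiff_empty] at this
    exact hρ.mul_eq_zero _ _ this

end

end BooleanKoszul

namespace GnKoszul

variable (k : Type) [Field k] (n : ℕ)

/-- The generator `r_A` viewed in the opposite algebra. -/
def gen (A : Finset (Fin n)) : GnOp k n := op (GnMk k n (rGen k n A))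

lemma gen_empty : gen k n ∅ = 0 := by simp [gen, rGen]

lemma sub_gen_mul_gen {A : Finset (Fin n)} {i j : Fin n} (hi : i ∈ A) (hj : j ∈ A) :
    (gen k n (A.erase i) - gen k n (A.erase j)) * gen k n A = 0 := by
  rw [gen, gen, gen, ← op_sub, ← op_mul, ← map_sub, ← map_mul, op_eq_zero_iff]
  exact (RingQuot.mkAlgHom_rel k (GnRel.rel A i j hi hj)).trans (map_zero _)

variable {k n}

lemma exists_eq_erase {A C : Finset (Fin n)} (hA : A.Nonempty)
    (hC : C ∈ powersetCard (A.card - 1) A) : ∃ i ∈ A, C = A.erase i := by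
  rw [mem_powersetCard] at hC
  have := hA.card_pos
  obtain ⟨i, hi, h⟩ := (exists_eq_insert_iff (s := C) (t := A)).2 ⟨hC.1, by omega⟩
  exact ⟨i, h ▸ mem_insert_self _ _, by rw [← h, erase_insert hi]⟩

lemma erase_mem_powersetCard {A : Finset (Fin n)} {i : Fin n} (hi : i ∈ A) :
    A.erase i ∈ powersetCard (A.card - 1) A :=
  mem_powersetCard.2 ⟨erase_subset _ _, card_erase_of_mem hi⟩

open BooleanKoszul

variable (k) in
/-- The cyclic module whose defining relations are those of the generator indexed by `D`. -/
abbrev CycMod (D : Finset (Fin n)) := GnOp k n ⧸ diffIdeal (gen k n) D (D.card - 1)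

variable (k) in
/-- The class of `1` in `CycMod k D`. -/
def cycOne (D : Finset (Fin n)) : CycMod k D := Submodule.Quotient.mk 1

variable (k) in
/-- The action of the generator indexed by `C` on the extension of the trivial module by
`CycMod k D`, in which the generator indexed by `D` maps `1` to `cycOne k D`. -/
def genEnd (D C : Finset (Fin n)) : Module.End k (k × CycMod k D) :=
  LinearMap.inr k k (CycMod k D) ∘ₗ LinearMap.coprod
    (if C = D then LinearMap.toSpanSingleton k _ (cycOne k D) else 0)
    (Algebra.lsmul k k (CycMod k D) (gen k n C))

lemma genEnd_apply (D C : Finset (Fin n)) (p : k × CycMod k D) :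
    genEnd k D C p = (0, (if C = D then p.1 • cycOne k D else 0) + gen k n C • p.2) := by
  unfold genEnd
  split_ifs <;> simp

lemma genEnd_mul_eq_zero (D : Finset (Fin n)) {A : Finset (Fin n)} {i j : Fin n} (hi : i ∈ A)
    (hj : j ∈ A) :
    (genEnd k D (A.erase i) - genEnd k D (A.erase j)) * genEnd k D A = 0 := by
  refine LinearMap.ext fun p => ?_
  have h : (gen k n (A.erase i) - gen k n (A.erase j)) •
      ((if A = D then p.1 • cycOne k D else 0) + gen k n A • p.2) = 0 := by
    rw [smul_add, smul_smul, sub_gen_mul_gen k n hi hj, zero_smul, add_zero]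
    split_ifs with hA
    · subst hA
      rw [smul_comm, cycOne, ← Submodule.Quotient.mk_smul, smul_eq_mul, mul_one,
        (Submodule.Quotient.mk_eq_zero _).2
          (sub_mem_diffIdeal (erase_mem_powersetCard hi) (erase_mem_powersetCard hj)), smul_zero]
    · exact smul_zero _
  rw [sub_smul] at h
  rw [Module.End.mul_apply, LinearMap.sub_apply, genEnd_apply, genEnd_apply, genEnd_apply]
  simpa using h

/-- `genEnd` as a representation of the free algebra. -/
def freeAction (D : Finset (Fin n)) : FreeA k n →ₐ[k] (Module.End k (k × CycMod k D))ᵐᵒᵖ :=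
  FreeAlgebra.lift k fun C => op (genEnd k D C.1)

lemma freeAction_rGen (D : Finset (Fin n)) {C : Finset (Fin n)} (hC : C.Nonempty) :
    freeAction D (rGen k n C) = op (genEnd k D C) := by
  rw [rGen, dif_pos hC, freeAction, FreeAlgebra.lift_ι_apply]

lemma freeAction_rel (D : Finset (Fin n)) ⦃x y : FreeA k n⦄ (h : GnRel k n x y) :
    freeAction D x = freeAction D y := by
  obtain ⟨A, i, j, hi, hj⟩ := h
  rw [map_zero, hRel]
  rcases eq_or_ne i j with rfl | hij
  · rw [sub_self, mul_zero, map_zero]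
  · rw [map_mul, map_sub, freeAction_rGen D ⟨i, hi⟩,
      freeAction_rGen D ⟨j, mem_erase.2 ⟨hij.symm, hj⟩⟩,
      freeAction_rGen D ⟨i, mem_erase.2 ⟨hij, hi⟩⟩, ← op_sub, ← op_mul,
      genEnd_mul_eq_zero D hi hj, op_zero]

/-- `genEnd` as a representation of the opposite algebra. -/
def action (D : Finset (Fin n)) : GnOp k n →ₐ[k] Module.End k (k × CycMod k D) :=
  AlgHom.opComm (RingQuot.liftAlgHom k ⟨freeAction D, freeAction_rel D⟩)

lemma action_op (D : Finset (Fin n)) (f : FreeA k n) :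
    action D (op (GnMk k n f)) = unop (freeAction D f) := by
  change unop (RingQuot.liftAlgHom k _ (RingQuot.mkAlgHom k _ f)) = _
  rw [RingQuot.liftAlgHom_mkAlgHom_apply]

lemma action_gen (D : Finset (Fin n)) {C : Finset (Fin n)} (hC : C.Nonempty) :
    action D (gen k n C) = genEnd k D C := by
  rw [gen, action_op, freeAction_rGen D hC, unop_op]

lemma GnOp_induction {p : GnOp k n → Prop} (algebraMap : ∀ c, p (algebraMap k _ c))
    (gen : ∀ C : Finset (Fin n), C.Nonempty → p (gen k n C))
    (mul : ∀ x y, p x → p y → p (x * y)) (add : ∀ x y, p x → p y → p (x + y))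
    (x : GnOp k n) : p x := by
  obtain ⟨f, rfl⟩ : ∃ f, op (GnMk k n f) = x :=
    (RingQuot.mkAlgHom_surjective k (GnRel k n) (unop x)).imp fun _ h => unop_injective h
  induction f using FreeAlgebra.induction with
  | grade0 c =>
    rw [AlgHom.commutes]
    exact algebraMap c
  | grade1 C =>
    have := gen C.1 C.2
    rwa [GnKoszul.gen, rGen, dif_pos C.2] at this
  | mul f g hf hg =>
    rw [map_mul, op_mul]
    exact mul _ _ hg hf
  | add f g hf hg =>
    rw [map_add, op_add]
    exact add _ _ hf hg

lemma action_apply_inr (D : Finset (Fin n)) (x : GnOp k n) (v : CycMod k D) :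
    action D x (0, v) = (0, x • v) := by
  induction x using GnOp_induction generalizing v with
  | algebraMap c =>
    rw [AlgHom.commutes, Module.algebraMap_end_apply, algebraMap_smul]
    simp
  | gen C hC => simp [action_gen D hC, genEnd_apply]
  | mul x y hx hy => rw [map_mul, Module.End.mul_apply, hy, hx, mul_smul]
  | add x y hx hy => rw [map_add, LinearMap.add_apply, hx, hy, add_smul]; simp

variable (k n) in
lemma isQuadratic_gen : IsQuadratic (gen k n) where
  mul_eq_zero D x hx := by
    rcases D.eq_empty_or_nonempty with rfl | hD
    · rw [gen_empty, mul_zero]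
    induction hx using Submodule.span_induction with
    | mem x h =>
      obtain ⟨C, hC, C', hC', rfl⟩ := h
      obtain ⟨i, hi, rfl⟩ := exists_eq_erase hD hC
      obtain ⟨j, hj, rfl⟩ := exists_eq_erase hD hC'
      exact sub_gen_mul_gen k n hi hj
    | zero => exact zero_mul _
    | add x y _ _ hx hy => rw [add_mul, hx, hy, add_zero]
    | smul r x _ hx => rw [smul_eq_mul, mul_assoc, hx, mul_zero]
  mem_of_sum_eq_zero S x hS h D hD := by
    have key : action D (∑ C ∈ S, x C * gen k n C) (1, 0) = (0, x D • cycOne k D) := by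
      rw [map_sum, LinearMap.sum_apply, sum_eq_single_of_mem D hD]
      · rw [map_mul, Module.End.mul_apply, action_gen D (hS D hD), genEnd_apply, if_pos rfl,
          action_apply_inr]
        simp
      · intro C hC hCD
        rw [map_mul, Module.End.mul_apply, action_gen D (hS C hC), genEnd_apply, if_neg hCD,
          action_apply_inr]
        simp
    rw [h, map_zero, LinearMap.zero_apply, eq_comm, Prod.mk_eq_zero, cycOne,
      ← Submodule.Quotient.mk_smul, smul_eq_mul, mul_one, Submodule.Quotient.mk_eq_zero] at key
    exact key.2

lemma gen_mem_GnOpDeg (C : Finset (Fin n)) : gen k n C ∈ GnOpDeg k n 1 := by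
  refine ⟨_, ⟨_, ?_, rfl⟩, rfl⟩
  rw [rGen]
  split_ifs with hC
  · exact Submodule.subset_span ⟨[⟨C, hC⟩], rfl, by simp⟩
  · exact zero_mem _

lemma mul_gen_mem_GnOpDeg {m : ℕ} {x : GnOp k n} (hx : x ∈ GnOpDeg k n m)
    (C : Finset (Fin n)) : x * gen k n C ∈ GnOpDeg k n (m + 1) := by
  obtain ⟨_, ⟨f, hf, rfl⟩, rfl⟩ := hx
  refine ⟨_, ⟨rGen k n C * f, ?_, rfl⟩, by simp [gen]⟩
  rw [rGen]
  split_ifs with hC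
  · induction hf using Submodule.span_induction with
    | mem f h =>
      obtain ⟨l, rfl, rfl⟩ := h
      exact Submodule.subset_span ⟨⟨C, hC⟩ :: l, rfl, by simp⟩
    | zero => rw [mul_zero]; exact zero_mem _
    | add f g _ _ hf hg => rw [mul_add]; exact add_mem hf hg
    | smul c f _ hf => rw [mul_smul_comm]; exact Submodule.smul_mem _ _ hf
  · rw [zero_mul]; exact zero_mem _

lemma mem_span_gen_of_mem_GnOpDeg {m : ℕ} {x : GnOp k n} (hx : x ∈ GnOpDeg k n (m + 1)) :
    x ∈ Submodule.span (GnOp k n) {y | ∃ C : Finset (Fin n), C.Nonempty ∧ y = gen k n C} := by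
  obtain ⟨_, ⟨f, hf, rfl⟩, rfl⟩ := hx
  induction hf using Submodule.span_induction with
  | mem f h =>
    obtain ⟨l, hl, rfl⟩ := h
    obtain ⟨C, l, rfl⟩ := List.exists_cons_of_length_eq_add_one hl
    have : gen k n C.1 = op (GnMk k n (FreeAlgebra.ι k C)) := by rw [gen, rGen, dif_pos C.2]
    have hC := Submodule.subset_span (R := GnOp k n)
      (show gen k n C.1 ∈ {y | ∃ C : Finset (Fin n), C.Nonempty ∧ y = gen k n C} from
        ⟨C.1, C.2, rfl⟩)
    rw [this] at hC
    simpa using Submodule.smul_mem _ (op (GnMk k n (l.map (FreeAlgebra.ι k)).prod)) hC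
  | zero => simp
  | add f g _ _ hf hg => simpa using add_mem hf hg
  | smul c f _ hf => simpa using Submodule.smul_of_tower_mem _ c hf

variable (k n) in
lemma augIdealG_eq_span : augIdealG k n =
    Submodule.span (GnOp k n) {y | ∃ C : Finset (Fin n), C.Nonempty ∧ y = gen k n C} := by
  refine le_antisymm (Submodule.span_le.2 ?_) (Submodule.span_mono ?_)
  · rintro x ⟨m, hm, hx⟩
    obtain ⟨m, rfl⟩ := Nat.exists_eq_add_of_le' hm
    exact mem_span_gen_of_mem_GnOpDeg hx
  · rintro _ ⟨C, -, rfl⟩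
    exact ⟨1, le_rfl, gen_mem_GnOpDeg C⟩

/-- Basis of the `i`-th term of the resolution. -/
def Basis (apex : Finset (Fin n) → Fin n) : ℕ → Type
  | 0 => Unit
  | i + 1 => ResIdx apex i

variable (k) in
/-- The differentials of the resolution. -/
def diff (apex : Finset (Fin n) → Fin n) :
    ∀ i, (Basis apex (i + 1) →₀ GnOp k n) →ₗ[GnOp k n] (Basis apex i →₀ GnOp k n)
  | 0 => Finsupp.lsingle () ∘ₗ
      Finsupp.linearCombination (GnOp k n) fun p : ResIdx apex 0 => gen k n p.1.1
  | i + 1 => resDiff (gen k n) apex i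

variable (k) in
/-- The augmentation of the resolution. -/
def augmentation (apex : Finset (Fin n) → Fin n) :
    (Basis apex 0 →₀ GnOp k n) →ₗ[GnOp k n] TrivG k n :=
  (augIdealG k n).mkQ ∘ₗ Finsupp.lapply ()

lemma range_gen (apex : Finset (Fin n) → Fin n) :
    Set.range (fun p : ResIdx apex 0 => gen k n p.1.1) =
      {y | ∃ C : Finset (Fin n), C.Nonempty ∧ y = gen k n C} := by
  ext y
  constructor
  · rintro ⟨p, rfl⟩
    exact ⟨p.1.1, p.2.1, rfl⟩
  · rintro ⟨C, hC, rfl⟩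
    exact ⟨⟨(C, ∅), by simpa using hC⟩, rfl⟩

lemma diff_zero_apply (apex : Finset (Fin n) → Fin n) (y : ResIdx apex 0 →₀ GnOp k n)
    (b : Basis apex 0) : diff k apex 0 y b =
      Finsupp.linearCombination (GnOp k n) (fun p : ResIdx apex 0 => gen k n p.1.1) y :=
  Finsupp.single_eq_same (a := ())

lemma ker_augmentation (apex : Finset (Fin n) → Fin n) :
    LinearMap.ker (augmentation k apex) = LinearMap.range (diff k apex 0) := by
  ext x
  have h : x ∈ LinearMap.ker (augmentation k apex) ↔ x () ∈ augIdealG k n :=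
    Submodule.Quotient.mk_eq_zero _
  rw [h, augIdealG_eq_span, ← range_gen apex, ← Finsupp.range_linearCombination]
  constructor
  · rintro ⟨y, hy⟩
    exact ⟨y, Finsupp.ext fun b => (diff_zero_apply apex y b).trans hy⟩
  · rintro ⟨y, rfl⟩
    exact ⟨y, (diff_zero_apply apex y ()).symm⟩

lemma ker_diff (apex : Finset (Fin n) → Fin n) (hapex : ∀ A, A.Nonempty → apex A ∈ A) (i : ℕ) :
    LinearMap.ker (diff k apex i) = LinearMap.range (diff k apex (i + 1)) := by
  cases i with
  | zero =>
    refine Eq.trans ?_ (ker_linearCombination (isQuadratic_gen k n) hapex)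
    exact Submodule.ext fun y =>
      ⟨fun h => (diff_zero_apply apex y ()).symm.trans (DFunLike.congr_fun h ()),
        fun h => Finsupp.ext fun b => (diff_zero_apply apex y b).trans h⟩
  | succ i => exact ker_resDiff (isQuadratic_gen k n) hapex

lemma mul_gen_mem_shiftDegG {i m : ℕ} {x : GnOp k n} (hx : x ∈ shiftDegG k n (i + 1) m)
    (C : Finset (Fin n)) : x * gen k n C ∈ shiftDegG k n i m := by
  rw [shiftDegG] at hx ⊢
  split_ifs at hx with h
  · rw [if_pos (by omega), show m - i = m - (i + 1) + 1 by omega]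
    exact mul_gen_mem_GnOpDeg hx C
  · rw [(Submodule.mem_bot k).1 hx, zero_mul]
    exact zero_mem _

lemma diff_mem_shiftDegG (apex : Finset (Fin n) → Fin n) (i m : ℕ)
    {x : Basis apex (i + 1) →₀ GnOp k n} (hx : ∀ b, x b ∈ shiftDegG k n (i + 1) m)
    (b : Basis apex i) : diff k apex i x b ∈ shiftDegG k n i m := by
  cases i with
  | zero =>
    exact ((diff_zero_apply apex x b).trans (Finsupp.linearCombination_apply _ _)).symm ▸
      sum_mem fun p _ => mul_gen_mem_shiftDegG (hx p) _
  | succ i =>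
    exact resDiff_mem (N := (shiftDegG k n (i + 1 + 1) m).toAddSubgroup)
      (N' := (shiftDegG k n (i + 1) m).toAddSubgroup)
      (fun _ hy D => mul_gen_mem_shiftDegG hy D) hx b

lemma augmentation_surjective (apex : Finset (Fin n) → Fin n) :
    Function.Surjective (augmentation k apex) :=
  (Submodule.mkQ_surjective _).comp fun r => ⟨Finsupp.single () r, Finsupp.single_eq_same⟩

lemma augmentation_eq_zero (apex : Finset (Fin n) → Fin n) {m : ℕ} (hm : 1 ≤ m)
    {x : Basis apex 0 →₀ GnOp k n} (hx : ∀ b, x b ∈ shiftDegG k n 0 m) :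
    augmentation k apex x = 0 :=
  (Submodule.Quotient.mk_eq_zero _).2 (Submodule.subset_span ⟨m, hm, hx ()⟩)

end GnKoszul

/-- `gn = gr Q_n` is Koszul. -/
theorem Gn_is_Koszul (k : Type) [Field k] (n : ℕ) (hn : 2 ≤ n) :
    ∃ (β : ℕ → Type)
      (d : ∀ i : ℕ, ((β (i + 1) →₀ GnOp k n) →ₗ[GnOp k n] (β i →₀ GnOp k n)))
      (ε : (β 0 →₀ GnOp k n) →ₗ[GnOp k n] TrivG k n),
      -- the resolution is exact: `⋯ → P_1 → P_0 → k → 0`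
      Function.Surjective ε ∧
      LinearMap.ker ε = LinearMap.range (d 0) ∧
      (∀ i : ℕ, LinearMap.ker (d i) = LinearMap.range (d (i + 1))) ∧
      -- all differentials preserve degrees (the free generators of `P_i` having degree `i`)
      (∀ (i m : ℕ) (x : β (i + 1) →₀ GnOp k n),
        (∀ b, x b ∈ shiftDegG k n (i + 1) m) → ∀ b, (d i x) b ∈ shiftDegG k n i m) ∧
      -- the augmentation preserves degrees (`k` is concentrated in degree `0`)
      (∀ m : ℕ, 1 ≤ m → ∀ x : β 0 →₀ GnOp k n,
        (∀ b, x b ∈ shiftDegG k n 0 m) → ε x = 0) := by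
  obtain ⟨apex, hapex⟩ : ∃ apex : Finset (Fin n) → Fin n, ∀ A, A.Nonempty → apex A ∈ A := by
    have : Nonempty (Fin n) := ⟨⟨0, by omega⟩⟩
    classical
    exact ⟨fun A => if h : A.Nonempty then h.choose else Classical.arbitrary _,
      fun A hA => by simpa [hA] using hA.choose_spec⟩
  exact ⟨GnKoszul.Basis apex, GnKoszul.diff k apex, GnKoszul.augmentation k apex,
    GnKoszul.augmentation_surjective apex, GnKoszul.ker_augmentation apex,
    GnKoszul.ker_diff apex hapex, fun i m _ hx => GnKoszul.diff_mem_shiftDegG apex i m hx,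
    fun _ hm _ hx => GnKoszul.augmentation_eq_zero apex hm hx⟩
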